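/- arXiv:2511.17325 — 3 statements merged into one kernel-verified Lean document; each statement's English description precedes it below -/
import Mathlib

section
/- Let n ≥ 1, s ∈ (0,1), α ∈ (0, min(2s,1)), 0 < r ≤ 1 and x ∈ ℝⁿ. Let h ∈ C^{1,1}_{loc}(B_r(x)) ∩ L_{2s} be nonnegative on ℝⁿ and satisfy (-Δ)^s h = 0 classically in B_r(x). Then [h]_{C^α(B_{r/2}(x))} ≤ C r^{−α} ‖h‖_{L^∞(B_r(x))}, where C depends only on n, s and α. -/
open MeasureTheory Metric Set Filter
open scoped Topology NNReal ENNReal RealInnerProductSpace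

noncomputable section

/-- `n`-dimensional Euclidean space `ℝⁿ`. -/
abbrev Euc (n : ℕ) := EuclideanSpace ℝ (Fin n)

/-- The standard normalization constant `C_{n,s}` of the fractional Laplacian,
`C_{n,s} = 4^s Γ(n/2+s) / (π^{n/2} |Γ(-s)|) = s·4^s·Γ(n/2+s) / (π^{n/2} Γ(1-s))`. -/
def fracC (n : ℕ) (s : ℝ) : ℝ :=
  s * 4 ^ s * Real.Gamma ((n : ℝ) / 2 + s) /
    (Real.pi ^ ((n : ℝ) / 2) * Real.Gamma (1 - s))

/-- `(-Δ)^s u (x) = v` in the classical (Cauchy principal value) sense: the truncated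
integrals `C_{n,s} ∫_{|x-y| ≥ ε} (u(x) - u(y))/|x-y|^{n+2s} dy` tend to `v` as `ε → 0⁺`. -/
def HasFracLapAt (n : ℕ) (s : ℝ) (u : Euc n → ℝ) (x : Euc n) (v : ℝ) : Prop :=
  Tendsto (fun ε : ℝ =>
      fracC n s *
        ∫ y in {y : Euc n | ε ≤ dist x y}, (u x - u y) / dist x y ^ ((n : ℝ) + 2 * s))
    (𝓝[>] (0 : ℝ)) (𝓝 v)

/-- The tail space `L_{2s}`: locally integrable functions with
`∫_{ℝⁿ} |u(y)|/(1+|y|^{n+2s}) dy < ∞`. -/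
def MemL2s (n : ℕ) (s : ℝ) (u : Euc n → ℝ) : Prop :=
  LocallyIntegrable u volume ∧
    Integrable (fun y : Euc n => |u y| / (1 + ‖y‖ ^ ((n : ℝ) + 2 * s))) volume

/-- The `L_{2s}` norm `‖u‖_{L_{2s}} = ∫_{ℝⁿ} |u(y)|/(1+|y|^{n+2s}) dy`. -/
def l2sNorm (n : ℕ) (s : ℝ) (u : Euc n → ℝ) : ℝ :=
  ∫ y : Euc n, |u y| / (1 + ‖y‖ ^ ((n : ℝ) + 2 * s))

/-- `u ∈ C^{1,1}_{loc}(Ω)`: near every point of `Ω`, `u` is `C^1` with a Lipschitz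
continuous derivative. -/
def C11LocOn (n : ℕ) (u : Euc n → ℝ) (Ω : Set (Euc n)) : Prop :=
  ∀ x ∈ Ω, ∃ ε > 0, ball x ε ⊆ Ω ∧ ContDiffOn ℝ 1 u (ball x ε) ∧
    ∃ L : ℝ≥0, LipschitzOnWith L (fun y => fderiv ℝ u y) (ball x ε)

/-- The `C^γ(K)` norm (`0 < γ < 1`) of `u` is bounded by `A`: both the sup norm and the
`γ`-Hölder seminorm of `u` on `K` are at most `A`. -/
def HolderBoundOn (n : ℕ) (γ : ℝ) (u : Euc n → ℝ) (K : Set (Euc n)) (A : ℝ) : Prop :=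
  (∀ x ∈ K, |u x| ≤ A) ∧ ∀ x ∈ K, ∀ y ∈ K, |u x - u y| ≤ A * dist x y ^ γ

/-- Two-sided (interior and exterior) tangent ball condition of radius `ρ` at a boundary
point `z` of `Ω`.  A uniform two-sided ball condition is the standard geometric
characterization of a (locally) `C^{1,1}` boundary: the radius `ρ` is controlled by the
local `C^{1,1}` norm of `∂Ω` and vice versa. -/
def TwoSidedBallAt (n : ℕ) (Ω : Set (Euc n)) (ρ : ℝ) (z : Euc n) : Prop :=
  ∃ ν : Euc n, ‖ν‖ = 1 ∧ ball (z + ρ • ν) ρ ⊆ Ω ∧ ball (z - ρ • ν) ρ ⊆ Ωᶜ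

lemma mem_compl_ball_zero {n : ℕ} {ε : ℝ} {w : Euc n} : w ∈ (ball (0 : Euc n) ε)ᶜ ↔ ε ≤ ‖w‖ := by
  simp

/-- The kernel `|w|^{-p}` is integrable at infinity when `p > n`. -/
lemma integrableOn_norm_rpow_compl_ball {n : ℕ} {p ε : ℝ} (hp : (n : ℝ) < p) (hε : 0 < ε) :
    IntegrableOn (fun w : Euc n => ‖w‖ ^ (-p)) (ball (0 : Euc n) ε)ᶜ := by
  have hp0 : 0 < p := lt_of_le_of_lt (Nat.cast_nonneg n) hp
  have h1 : Integrable (fun w : Euc n => (ε / (1 + ε)) ^ (-p) * (1 + ‖w‖) ^ (-p)) :=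
    (integrable_one_add_norm (by simpa using hp)).const_mul _
  refine Integrable.mono' h1.integrableOn (Measurable.aestronglyMeasurable (by fun_prop)) ?_
  filter_upwards [ae_restrict_mem measurableSet_ball.compl] with w hw
  rw [mem_compl_ball_zero] at hw
  have hw0 : 0 < ‖w‖ := hε.trans_le hw
  rw [Real.norm_of_nonneg (by positivity), ← Real.mul_rpow (by positivity) (by positivity)]
  refine Real.rpow_le_rpow_of_nonpos (by positivity) ?_ (by linarith)
  rw [div_mul_eq_mul_div, div_le_iff₀ (by positivity)]
  nlinarith

/-- The function `|w|^{2-p}` is integrable near the origin when `p < n + 2`. -/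
lemma integrableOn_sq_norm_rpow_ball {n : ℕ} {p ρ : ℝ} (hn : 1 ≤ n) (hp : p < n + 2)
    (hρ : 0 < ρ) :
    IntegrableOn (fun w : Euc n => ‖w‖ ^ 2 * ‖w‖ ^ (-p)) (ball (0 : Euc n) ρ) := by
  have : Nonempty (Fin n) := ⟨⟨0, hn⟩⟩
  rw [← integrable_indicator_iff measurableSet_ball]
  have key := (integrable_fun_norm_addHaar (volume : Measure (Euc n))
    (f := (Iio ρ).indicator (fun t : ℝ => t ^ 2 * t ^ (-p)))).2 ?_
  · refine key.congr (Eventually.of_forall fun w => ?_)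
    simp only [indicator, mem_Iio, mem_ball, dist_zero_right]
  · have h2 : IntegrableOn (fun t : ℝ => t ^ ((n : ℝ) + 1 - p)) (Ioo 0 ρ) :=
      (intervalIntegral.integrableOn_Ioo_rpow_iff hρ).2 (by linarith)
    rw [← integrable_indicator_iff measurableSet_Ioo] at h2
    rw [← integrable_indicator_iff measurableSet_Ioi]
    refine h2.congr (Eventually.of_forall fun t => ?_)
    simp only [indicator, mem_Ioo, mem_Ioi, mem_Iio, smul_eq_mul, finrank_euclideanSpace,
      Fintype.card_fin]
    by_cases ht : 0 < t
    · by_cases htρ : t < ρ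
      · simp only [ht, htρ, and_self, if_true]
        rw [← Real.rpow_natCast t (n - 1), ← Real.rpow_natCast t 2, ← Real.rpow_add ht,
          ← Real.rpow_add ht, Nat.cast_sub hn]
        congr 1
        push_cast
        ring
      · simp [htρ]
    · simp [ht]

lemma integral_eq_zero_of_odd {n : ℕ} {f : Euc n → ℝ} (hf : ∀ w, f (-w) = -f w) :
    ∫ w, f w = 0 := by
  have h := integral_neg_eq_self f (volume : Measure (Euc n))
  simp only [hf, integral_neg] at h
  linarith

/-- The quadratic increment `|v + w|^2 - |v|^2`, truncated to `|w| < ρ` and weighted by the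
kernel `|w|^{-p}`. -/
def quadInc {n : ℕ} (p ρ : ℝ) (v w : Euc n) : ℝ :=
  (ball (0 : Euc n) ρ).indicator (fun w => (2 * ⟪v, w⟫ + ‖w‖ ^ 2) * ‖w‖ ^ (-p)) w

lemma integrableOn_quadInc {n : ℕ} {p ε : ℝ} (ρ : ℝ) (hp : (n : ℝ) < p) (hε : 0 < ε) (v : Euc n) :
    IntegrableOn (quadInc p ρ v) (ball (0 : Euc n) ε)ᶜ := by
  have hk := integrableOn_norm_rpow_compl_ball hp hε
  refine Integrable.mono' (hk.const_mul (2 * ‖v‖ * |ρ| + ρ ^ 2)) ?_ ?_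
  · exact (Measurable.indicator (by fun_prop) measurableSet_ball).aestronglyMeasurable
  · refine Eventually.of_forall fun w => ?_
    unfold quadInc
    by_cases hw : w ∈ ball (0 : Euc n) ρ
    · rw [indicator_of_mem hw, norm_mul, Real.norm_of_nonneg (r := ‖w‖ ^ (-p)) (by positivity)]
      refine mul_le_mul_of_nonneg_right ?_ (by positivity)
      rw [mem_ball_zero_iff] at hw
      have hρ : 0 < ρ := (norm_nonneg w).trans_lt hw
      have h1 := abs_real_inner_le_norm v w
      have h2 : ‖v‖ * ‖w‖ ≤ ‖v‖ * |ρ| := by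
        rw [abs_of_pos hρ]; gcongr
      have h3 : ‖w‖ ^ 2 ≤ ρ ^ 2 := by gcongr
      rw [Real.norm_eq_abs, abs_le]
      rw [abs_le] at h1
      constructor <;> nlinarith [sq_nonneg ‖w‖]
    · rw [indicator_of_notMem hw, norm_zero]
      positivity

lemma integral_quadInc_le {n : ℕ} {p ε ρ : ℝ} (hn : 1 ≤ n) (hp : (n : ℝ) < p)
    (hp2 : p < n + 2) (hε : 0 < ε) (hρ : 0 < ρ) (v : Euc n) :
    ∫ w in (ball (0 : Euc n) ε)ᶜ, quadInc p ρ v w ≤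
      ∫ w in ball (0 : Euc n) ρ, ‖w‖ ^ 2 * ‖w‖ ^ (-p) := by
  have hB := integrableOn_sq_norm_rpow_ball hn hp2 hρ
  have hq := integrableOn_quadInc ρ hp hε v
  rw [← integrable_indicator_iff measurableSet_ball.compl] at hq
  rw [← integrable_indicator_iff measurableSet_ball] at hB
  rw [← integral_indicator measurableSet_ball.compl, ← integral_indicator measurableSet_ball]
  have hsym : ∫ w, (ball (0 : Euc n) ε)ᶜ.indicator (quadInc p ρ v) (-w) =
      ∫ w, (ball (0 : Euc n) ε)ᶜ.indicator (quadInc p ρ v) w := integral_neg_eq_self _ _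
  have hle : ∫ w, ((ball (0 : Euc n) ε)ᶜ.indicator (quadInc p ρ v) w +
      (ball (0 : Euc n) ε)ᶜ.indicator (quadInc p ρ v) (-w)) ≤
      ∫ w, 2 * (ball (0 : Euc n) ρ).indicator (fun w => ‖w‖ ^ 2 * ‖w‖ ^ (-p)) w := by
    refine integral_mono (hq.add hq.comp_neg) (hB.const_mul 2) fun w => ?_
    have hpos : 0 ≤ ‖w‖ ^ 2 * ‖w‖ ^ (-p) := by positivity
    simp only [quadInc, indicator, mem_compl_iff, mem_ball_zero_iff, norm_neg, inner_neg_right]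
    split_ifs <;> linarith
  rw [integral_add hq hq.comp_neg, hsym, integral_const_mul] at hle
  linarith

/-- A nonnegative function on `ℝⁿ`, continuous and bounded by one in the unit ball, and
annihilated there by the operator with kernel `|w|^{-p}` in the principal value sense. -/
structure UnitHarmonic (n : ℕ) (p : ℝ) (g : Euc n → ℝ) : Prop where
  nonneg : ∀ y, 0 ≤ g y
  continuousOn : ContinuousOn g (ball 0 1)
  le_one : ∀ y ∈ ball (0 : Euc n) 1, g y ≤ 1
  integrableOn : ∀ y ∈ ball (0 : Euc n) 1, ∀ ε > 0,
    IntegrableOn (fun w => g (y + w) * ‖w‖ ^ (-p)) (ball (0 : Euc n) ε)ᶜ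
  tendsto : ∀ y ∈ ball (0 : Euc n) 1,
    Tendsto (fun ε : ℝ => ∫ w in (ball (0 : Euc n) ε)ᶜ, (g y - g (y + w)) * ‖w‖ ^ (-p))
      (𝓝[>] 0) (𝓝 0)

lemma UnitHarmonic.integrableOn_sub {n : ℕ} {p : ℝ} {g : Euc n → ℝ} (hg : UnitHarmonic n p g)
    (hp : (n : ℝ) < p) {y : Euc n} (hy : y ∈ ball (0 : Euc n) 1) {ε : ℝ} (hε : 0 < ε) :
    IntegrableOn (fun w => (g y - g (y + w)) * ‖w‖ ^ (-p)) (ball (0 : Euc n) ε)ᶜ := by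
  simp only [sub_mul]
  exact ((integrableOn_norm_rpow_compl_ball hp hε).const_mul _).sub (hg.integrableOn y hy ε hε)

lemma compl_ball_inter_of_le {n : ℕ} {ε ρ : ℝ} (h : ε ≤ ρ) :
    (ball (0 : Euc n) ε)ᶜ ∩ (ball (0 : Euc n) ρ)ᶜ = (ball (0 : Euc n) ρ)ᶜ :=
  inter_eq_right.2 (compl_subset_compl.2 (ball_subset_ball h))

/-- Touching `g` from below by a paraboloid at a point `x₁` controls its tail around `x₁`. -/
lemma UnitHarmonic.exists_tail_le {n : ℕ} {p : ℝ} (hn : 1 ≤ n) (hp : (n : ℝ) < p)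
    (hp2 : p < n + 2) {g : Euc n → ℝ} (hg : UnitHarmonic n p g) :
    ∃ x₁ : Euc n, ‖x₁‖ ≤ 1 / 2 ∧
      ∫ w in (ball (0 : Euc n) (1 / 4))ᶜ, g (x₁ + w) * ‖w‖ ^ (-p) ≤
        4 * (∫ w in ball (0 : Euc n) (1 / 4), ‖w‖ ^ 2 * ‖w‖ ^ (-p)) +
          ∫ w in (ball (0 : Euc n) (1 / 4))ᶜ, ‖w‖ ^ (-p) := by
  have hsub : closedBall (0 : Euc n) (3 / 4) ⊆ ball 0 1 := closedBall_subset_ball (by norm_num)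
  obtain ⟨x₁, hx₁K, hmin⟩ := (isCompact_closedBall (0 : Euc n) (3 / 4)).exists_isMinOn
    (f := fun u => g u + 4 * ‖u‖ ^ 2) ⟨0, by simp; norm_num⟩
    ((hg.continuousOn.mono hsub).add (by fun_prop))
  have hmin' : ∀ u ∈ closedBall (0 : Euc n) (3 / 4), g x₁ + 4 * ‖x₁‖ ^ 2 ≤ g u + 4 * ‖u‖ ^ 2 :=
    fun u hu => hmin hu
  have hx₁ : ‖x₁‖ ≤ 1 / 2 := by
    have h0 := hmin' 0 (by simp; norm_num)
    have h1 := hg.le_one 0 (by simp)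
    have h2 := hg.nonneg x₁
    rw [norm_zero] at h0
    nlinarith [norm_nonneg x₁]
  have hx₁b : x₁ ∈ ball (0 : Euc n) 1 := hsub hx₁K
  refine ⟨x₁, hx₁, ?_⟩
  set J := ∫ w in ball (0 : Euc n) (1 / 4), ‖w‖ ^ 2 * ‖w‖ ^ (-p)
  set K := ∫ w in (ball (0 : Euc n) (1 / 4))ᶜ, ‖w‖ ^ (-p)
  set T := ∫ w in (ball (0 : Euc n) (1 / 4))ᶜ, g (x₁ + w) * ‖w‖ ^ (-p)
  have hlim : (0 : ℝ) ≤ 4 * J + K - T := by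
    refine le_of_tendsto (hg.tendsto x₁ hx₁b) ?_
    filter_upwards [Ioo_mem_nhdsGT (show (0 : ℝ) < 1 / 4 by norm_num)] with ε hε
    have hq := integrableOn_quadInc (1 / 4) hp hε.1 x₁
    have hk := (integrableOn_norm_rpow_compl_ball hp hε.1).indicator
      (measurableSet_ball (x := (0 : Euc n)) (ε := 1 / 4)).compl
    have ht := (hg.integrableOn x₁ hx₁b ε hε.1).indicator
      (measurableSet_ball (x := (0 : Euc n)) (ε := 1 / 4)).compl
    have hle := setIntegral_mono_on (hg.integrableOn_sub hp hx₁b hε.1)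
      (((hq.const_mul 4).add hk).sub ht) measurableSet_ball.compl (fun w _ => ?_)
    · simp only [Pi.add_apply, Pi.sub_apply] at hle
      rw [integral_sub (f := fun w => 4 * quadInc p (1 / 4) x₁ w +
          (ball (0 : Euc n) (1 / 4))ᶜ.indicator (fun w => ‖w‖ ^ (-p)) w)
          ((hq.const_mul 4).add hk) ht,
        integral_add (hq.const_mul 4) hk, integral_const_mul,
        setIntegral_indicator measurableSet_ball.compl,
        setIntegral_indicator measurableSet_ball.compl, compl_ball_inter_of_le hε.2.le] at hle
      have hJ := integral_quadInc_le hn hp hp2 hε.1 (show (0 : ℝ) < 1 / 4 by norm_num) x₁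
      change _ ≤ _ + K - T at hle
      linarith
    · have hpos : 0 ≤ ‖w‖ ^ (-p) := by positivity
      simp only [Pi.add_apply, Pi.sub_apply, quadInc, indicator, mem_compl_iff, mem_ball_zero_iff]
      by_cases hw : ‖w‖ < 1 / 4
      · simp only [hw, not_true, if_true, if_false]
        have h1 := hmin' (x₁ + w) (by
          rw [mem_closedBall_zero_iff]
          linarith [norm_add_le x₁ w])
        have h2 := norm_add_sq_real x₁ w
        have h3 : g x₁ - g (x₁ + w) ≤ 4 * (2 * ⟪x₁, w⟫ + ‖w‖ ^ 2) := by linarith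
        nlinarith [mul_le_mul_of_nonneg_right h3 hpos]
      · simp only [hw, not_false_eq_true, if_true, if_false]
        have h1 := hg.le_one x₁ hx₁b
        nlinarith
  linarith

/-- Uniform tail bound around every point of the ball of radius `9/16`. -/
lemma exists_tail_bound {n : ℕ} {p : ℝ} (hn : 1 ≤ n) (hp : (n : ℝ) < p) (hp2 : p < n + 2) :
    ∃ C : ℝ, 0 ≤ C ∧ ∀ g : Euc n → ℝ, UnitHarmonic n p g → ∀ y ∈ ball (0 : Euc n) (9 / 16),
      ∫ w in (ball (0 : Euc n) (1 / 16))ᶜ, g (y + w) * ‖w‖ ^ (-p) ≤ C := by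
  have hp0 : 0 < p := lt_of_le_of_lt (Nat.cast_nonneg n) hp
  refine ⟨(∫ w in (ball (0 : Euc n) (1 / 16))ᶜ, ‖w‖ ^ (-p)) + 18 ^ p *
    (4 * (∫ w in ball (0 : Euc n) (1 / 4), ‖w‖ ^ 2 * ‖w‖ ^ (-p)) +
          ∫ w in (ball (0 : Euc n) (1 / 4))ᶜ, ‖w‖ ^ (-p)), by positivity, fun g hg y hy => ?_⟩
  obtain ⟨x₁, hx₁, hT⟩ := hg.exists_tail_le hn hp hp2
  rw [mem_ball_zero_iff] at hy
  have hyb : y ∈ ball (0 : Euc n) 1 := by rw [mem_ball_zero_iff]; linarith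
  have hxb : x₁ ∈ ball (0 : Euc n) 1 := by rw [mem_ball_zero_iff]; linarith
  have i1 := hg.integrableOn y hyb (1 / 16) (by norm_num)
  have i2 := integrableOn_norm_rpow_compl_ball (n := n) hp (show (0 : ℝ) < 1 / 16 by norm_num)
  have i3 := hg.integrableOn x₁ hxb (1 / 4) (by norm_num)
  rw [← integrable_indicator_iff measurableSet_ball.compl] at i1 i2 i3
  have hle := integral_mono (i1.comp_sub_right y)
    ((i2.comp_sub_right y).add ((i3.comp_sub_right x₁).const_mul (18 ^ p))) (fun u => ?_)
  · simp only [Pi.add_apply] at hle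
    rw [integral_add (i2.comp_sub_right y) ((i3.comp_sub_right x₁).const_mul (18 ^ p)),
      integral_const_mul, integral_sub_right_eq_self, integral_sub_right_eq_self,
      integral_sub_right_eq_self, integral_indicator measurableSet_ball.compl,
      integral_indicator measurableSet_ball.compl,
      integral_indicator measurableSet_ball.compl] at hle
    refine hle.trans ?_
    gcongr
  · have hg0 := hg.nonneg u
    have hk1 : 0 ≤ ‖u - y‖ ^ (-p) := by positivity
    have hk2 : 0 ≤ ‖u - x₁‖ ^ (-p) := by positivity
    simp only [Pi.add_apply, indicator, mem_compl_iff, mem_ball_zero_iff, add_sub_cancel]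
    have h18 : (0 : ℝ) ≤ 18 ^ p := by positivity
    by_cases h1 : ‖u - y‖ < 1 / 16
    · simp only [h1, not_true, if_false]
      split_ifs <;> positivity
    · simp only [h1, not_false_eq_true, if_true]
      by_cases h2 : ‖u - x₁‖ < 1 / 4
      · simp only [h2, not_true, if_false]
        have h3 : g u ≤ 1 := hg.le_one u (by
          rw [mem_ball_zero_iff]
          have := norm_add_le (u - x₁) x₁
          rw [sub_add_cancel] at this
          linarith)
        nlinarith
      · simp only [h2, not_false_eq_true, if_true]
        push Not at h1 h2
        have h3 : ‖u - x₁‖ ≤ 18 * ‖u - y‖ := by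
          have := norm_add_le (u - y) (y - x₁)
          rw [sub_add_sub_cancel] at this
          linarith [norm_sub_le y x₁]
        have h4 : ‖u - y‖ ^ (-p) ≤ 18 ^ p * ‖u - x₁‖ ^ (-p) := by
          have h5 : (18 * ‖u - y‖) ^ (-p) ≤ ‖u - x₁‖ ^ (-p) :=
            Real.rpow_le_rpow_of_nonpos (by linarith) h3 (by linarith)
          rw [Real.mul_rpow (by norm_num) (norm_nonneg _)] at h5
          have h6 : (18 : ℝ) ^ p * 18 ^ (-p) = 1 := by
            rw [← Real.rpow_add (by norm_num)]; simp
          calc ‖u - y‖ ^ (-p) = 18 ^ p * (18 ^ (-p) * ‖u - y‖ ^ (-p)) := by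
                rw [← mul_assoc, h6, one_mul]
            _ ≤ _ := by gcongr
        nlinarith [mul_le_mul_of_nonneg_left h4 hg0]

/-- The symmetric region on which displacements of the two points are taken to be opposite. -/
def swapRegion {n : ℕ} (δ : ℝ) (a : Euc n) : Set (Euc n) :=
  {w | ‖a - (2 : ℝ) • w‖ < δ * ‖a‖} ∪ {w | ‖a + (2 : ℝ) • w‖ < δ * ‖a‖}

lemma measurableSet_swapRegion {n : ℕ} (δ : ℝ) (a : Euc n) : MeasurableSet (swapRegion δ a) :=
  (measurableSet_lt (by fun_prop) (by fun_prop)).union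
    (measurableSet_lt (by fun_prop) (by fun_prop))

lemma neg_mem_swapRegion {n : ℕ} {δ : ℝ} {a w : Euc n} :
    -w ∈ swapRegion δ a ↔ w ∈ swapRegion δ a := by
  simp only [swapRegion, mem_union, mem_ofPred_eq, smul_neg, sub_neg_eq_add, ← sub_eq_add_neg]
  exact or_comm

lemma indicator_swapRegion_neg {n : ℕ} {δ : ℝ} {a : Euc n} (f : Euc n → ℝ) (w : Euc n) :
    (swapRegion δ a).indicator f (-w) = (swapRegion δ a).indicator (fun w => f (-w)) w := by
  by_cases hw : w ∈ swapRegion δ a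
  · rw [indicator_of_mem hw, indicator_of_mem (neg_mem_swapRegion.2 hw)]
  · rw [indicator_of_notMem hw, indicator_of_notMem (fun h => hw (neg_mem_swapRegion.1 h))]

lemma norm_bounds_of_mem_swapRegion {n : ℕ} {δ : ℝ} (hδ : δ ≤ 1 / 2) {a w : Euc n}
    (hw : w ∈ swapRegion δ a) : ‖a‖ / 4 ≤ ‖w‖ ∧ ‖w‖ ≤ ‖a‖ := by
  have ha := norm_nonneg a
  have h2 : ‖(2 : ℝ) • w‖ = 2 * ‖w‖ := by rw [norm_smul]; norm_num
  have h4 : ‖(-2 : ℝ) • w‖ = 2 * ‖w‖ := by rw [norm_smul]; norm_num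
  have h3 : δ * ‖a‖ ≤ 1 / 2 * ‖a‖ := by gcongr
  rcases hw with hw | hw
  · have h5 := abs_norm_sub_norm_le a ((2 : ℝ) • w)
    rw [h2, abs_le] at h5
    rw [mem_ofPred_eq] at hw
    constructor <;> linarith
  · have h5 := abs_norm_sub_norm_le a ((-2 : ℝ) • w)
    rw [neg_smul, sub_neg_eq_add, ← neg_smul, h4, abs_le] at h5
    rw [mem_ofPred_eq] at hw
    constructor <;> linarith

lemma exists_concavity_gap {α : ℝ} (hα0 : 0 < α) (hα1 : α < 1) :
    ∃ δ : ℝ, 0 < δ ∧ δ ≤ 1 / 2 ∧ (2 + δ) ^ α + δ ^ α < 2 := by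
  have hc : ContinuousAt (fun δ : ℝ => (2 + δ) ^ α + δ ^ α) 0 :=
    ((continuousAt_const.add continuousAt_id).rpow_const (Or.inr hα0.le)).add
      (continuousAt_id.rpow_const (Or.inr hα0.le))
  have h0 : (2 + (0 : ℝ)) ^ α + (0 : ℝ) ^ α < 2 := by
    rw [Real.zero_rpow hα0.ne', add_zero, add_zero]
    calc (2 : ℝ) ^ α < 2 ^ (1 : ℝ) := Real.rpow_lt_rpow_of_exponent_lt (by norm_num) hα1
      _ = 2 := by simp
  have h1 : ∀ᶠ δ in 𝓝[>] (0 : ℝ), (2 + δ) ^ α + δ ^ α < 2 :=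
    (hc.eventually_lt continuousAt_const h0).filter_mono nhdsWithin_le_nhds
  obtain ⟨δ, hδ, hδ2⟩ :=
    (h1.and (Ioc_mem_nhdsGT (show (0 : ℝ) < 1 / 2 by norm_num))).exists
  exact ⟨δ, hδ2.1, hδ2.2, hδ⟩

/-- The decrease of `|a|^α` when the two endpoints of `a` are moved by `w` and `-w`, weighted by
the kernel. -/
def swapGain {n : ℕ} (α p : ℝ) (a w : Euc n) : ℝ :=
  (‖a‖ ^ α - ‖a + (2 : ℝ) • w‖ ^ α) * ‖w‖ ^ (-p)

lemma integrableOn_swapGain {n : ℕ} {α p δ : ℝ} (hα0 : 0 < α) (hp : (n : ℝ) < p)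
    (hδ : δ ≤ 1 / 2) {a : Euc n} (ha : a ≠ 0) :
    IntegrableOn (swapGain α p a) (swapRegion δ a) := by
  have ha0 : 0 < ‖a‖ := norm_pos_iff.2 ha
  have hk : IntegrableOn (fun w : Euc n => ‖w‖ ^ (-p)) (swapRegion δ a) :=
    (integrableOn_norm_rpow_compl_ball hp (show 0 < ‖a‖ / 4 by positivity)).mono_set
      fun w hw => mem_compl_ball_zero.2 (norm_bounds_of_mem_swapRegion hδ hw).1
  refine Integrable.mono' (hk.const_mul (‖a‖ ^ α + (3 * ‖a‖) ^ α)) ?_ ?_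
  · unfold swapGain
    exact Measurable.aestronglyMeasurable (by fun_prop)
  · filter_upwards [ae_restrict_mem (measurableSet_swapRegion δ a)] with w hw
    have h1 := (norm_bounds_of_mem_swapRegion hδ hw).2
    have h2 : ‖a + (2 : ℝ) • w‖ ≤ 3 * ‖a‖ := by
      refine (norm_add_le _ _).trans ?_
      rw [norm_smul, Real.norm_ofNat]
      linarith
    have h3 : ‖a + (2 : ℝ) • w‖ ^ α ≤ (3 * ‖a‖) ^ α := by gcongr
    have h4 : 0 ≤ ‖a + (2 : ℝ) • w‖ ^ α := by positivity
    have h5 : 0 ≤ ‖a‖ ^ α := by positivity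
    rw [swapGain, norm_mul, Real.norm_of_nonneg (r := ‖w‖ ^ (-p)) (by positivity)]
    refine mul_le_mul_of_nonneg_right ?_ (by positivity)
    rw [Real.norm_eq_abs, abs_le]
    constructor <;> linarith

lemma swapGain_add_neg_ge {n : ℕ} {α p δ : ℝ} (hα0 : 0 < α) (hp0 : 0 < p) (hδ0 : 0 < δ)
    (hδ : δ ≤ 1 / 2) (hgap : (2 + δ) ^ α + δ ^ α < 2) {a w : Euc n} (ha : a ≠ 0)
    (hw : w ∈ swapRegion δ a) :
    (2 - ((2 + δ) ^ α + δ ^ α)) * (‖a‖ ^ α * ‖a‖ ^ (-p)) ≤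
      swapGain α p a w + swapGain α p a (-w) := by
  have ha0 : 0 < ‖a‖ := norm_pos_iff.2 ha
  have hb := norm_bounds_of_mem_swapRegion hδ hw
  have hw0 : 0 < ‖w‖ := by linarith
  have hk : ‖a‖ ^ (-p) ≤ ‖w‖ ^ (-p) := Real.rpow_le_rpow_of_nonpos hw0 hb.2 (by linarith)
  have hsum : ‖a + (2 : ℝ) • w‖ ^ α + ‖a - (2 : ℝ) • w‖ ^ α ≤
      ((2 + δ) ^ α + δ ^ α) * ‖a‖ ^ α := by
    rw [add_mul, ← Real.mul_rpow (by positivity) ha0.le, ← Real.mul_rpow hδ0.le ha0.le]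
    have h2a : ‖(2 : ℝ) • a‖ = 2 * ‖a‖ := by rw [norm_smul, Real.norm_ofNat]
    rcases hw with hw | hw
    · rw [mem_ofPred_eq] at hw
      have h1 : ‖a + (2 : ℝ) • w‖ ≤ (2 + δ) * ‖a‖ := by
        have h := norm_sub_le ((2 : ℝ) • a) (a - (2 : ℝ) • w)
        rw [show (2 : ℝ) • a - (a - (2 : ℝ) • w) = a + (2 : ℝ) • w by module] at h
        linarith
      gcongr
    · rw [mem_ofPred_eq] at hw
      have h1 : ‖a - (2 : ℝ) • w‖ ≤ (2 + δ) * ‖a‖ := by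
        have h := norm_sub_le ((2 : ℝ) • a) (a + (2 : ℝ) • w)
        rw [show (2 : ℝ) • a - (a + (2 : ℝ) • w) = a - (2 : ℝ) • w by module] at h
        linarith
      rw [add_comm]
      gcongr
  calc (2 - ((2 + δ) ^ α + δ ^ α)) * (‖a‖ ^ α * ‖a‖ ^ (-p))
      ≤ (2 - ((2 + δ) ^ α + δ ^ α)) * (‖a‖ ^ α * ‖w‖ ^ (-p)) := by
        have : 0 ≤ 2 - ((2 + δ) ^ α + δ ^ α) := by linarith
        gcongr
    _ = (2 * ‖a‖ ^ α - ((2 + δ) ^ α + δ ^ α) * ‖a‖ ^ α) * ‖w‖ ^ (-p) := by ring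
    _ ≤ (2 * ‖a‖ ^ α - (‖a + (2 : ℝ) • w‖ ^ α + ‖a - (2 : ℝ) • w‖ ^ α)) * ‖w‖ ^ (-p) := by
        gcongr
    _ = swapGain α p a w + swapGain α p a (-w) := by
        simp only [swapGain, norm_neg, smul_neg, ← sub_eq_add_neg]
        ring

lemma exists_swapGain_lower_bound {n : ℕ} {α p δ : ℝ} (hn : 1 ≤ n) (hα0 : 0 < α)
    (hp : n + α ≤ p) (hδ0 : 0 < δ) (hδ : δ ≤ 1 / 2) (hgap : (2 + δ) ^ α + δ ^ α < 2) :
    ∃ c : ℝ, 0 < c ∧ ∀ a : Euc n, a ≠ 0 → ‖a‖ ≤ 1 →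
      c ≤ ∫ w in swapRegion δ a, swapGain α p a w := by
  have : Nonempty (Fin n) := ⟨⟨0, hn⟩⟩
  have hnp : (n : ℝ) < p := by linarith
  have hp0 : 0 < p := lt_of_le_of_lt (Nat.cast_nonneg n) hnp
  set κ := 2 - ((2 + δ) ^ α + δ ^ α) with hκ
  have hκ0 : 0 < κ := by linarith
  set ω := volume.real (ball (0 : Euc n) 1) with hω
  have hω0 : 0 < ω := ENNReal.toReal_pos (measure_ball_pos _ _ one_pos).ne' measure_ball_lt_top.ne
  refine ⟨(δ / 2) ^ n * ω * κ / 2, by positivity, fun a ha ha1 => ?_⟩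
  have ha0 : 0 < ‖a‖ := norm_pos_iff.2 ha
  have hint := integrableOn_swapGain (p := p) hα0 hnp hδ ha
  have hintn : IntegrableOn (fun w => swapGain α p a (-w)) (swapRegion δ a) := by
    rw [← integrable_indicator_iff (measurableSet_swapRegion δ a)] at hint ⊢
    refine hint.comp_neg.congr (Eventually.of_forall fun w => ?_)
    exact indicator_swapRegion_neg _ w
  have hsym : ∫ w in swapRegion δ a, swapGain α p a (-w) =
      ∫ w in swapRegion δ a, swapGain α p a w := by
    rw [← integral_indicator (measurableSet_swapRegion δ a),
      ← integral_indicator (measurableSet_swapRegion δ a), ← integral_neg_eq_self]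
    simp only [indicator_swapRegion_neg, neg_neg]
  have hfin : volume (swapRegion δ a) ≠ ⊤ := by
    refine ne_top_of_le_ne_top (measure_closedBall_lt_top (x := (0 : Euc n)) (r := ‖a‖)).ne
      (measure_mono fun w hw => ?_)
    exact mem_closedBall_zero_iff.2 (norm_bounds_of_mem_swapRegion hδ hw).2
  have hge := setIntegral_ge_of_const_le (measurableSet_swapRegion δ a) hfin
    (fun w hw => swapGain_add_neg_ge hα0 hp0 hδ0 hδ hgap ha hw) (hint.add hintn)
  rw [integral_add hint hintn, hsym, smul_eq_mul, ← hκ] at hge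
  have hvol : (δ / 2) ^ n * ‖a‖ ^ n * ω ≤ volume.real (swapRegion δ a) := by
    have h1 : volume.real (ball ((1 / 2 : ℝ) • a) (δ * ‖a‖ / 2)) ≤
        volume.real (swapRegion δ a) := by
      refine measureReal_mono (fun w hw => Or.inl ?_) hfin
      rw [mem_ball_iff_norm'] at hw
      rw [mem_ofPred_eq, show a - (2 : ℝ) • w = (2 : ℝ) • ((1 / 2 : ℝ) • a - w) by module,
        norm_smul, Real.norm_ofNat]
      linarith
    refine le_trans (le_of_eq ?_) h1
    rw [measureReal_def, Measure.addHaar_ball _ _ (by positivity), ENNReal.toReal_mul,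
      ENNReal.toReal_ofReal (by positivity), finrank_euclideanSpace, Fintype.card_fin, hω,
      measureReal_def]
    ring
  have hpow : 1 ≤ ‖a‖ ^ n * (‖a‖ ^ α * ‖a‖ ^ (-p)) := by
    rw [← Real.rpow_natCast, ← Real.rpow_add ha0, ← Real.rpow_add ha0]
    exact Real.one_le_rpow_of_pos_of_le_one_of_nonpos ha0 ha1 (by linarith)
  have hfinal : (δ / 2) ^ n * ω * κ ≤
      volume.real (swapRegion δ a) * (κ * (‖a‖ ^ α * ‖a‖ ^ (-p))) :=
    calc (δ / 2) ^ n * ω * κ ≤ (δ / 2) ^ n * ω * κ * (‖a‖ ^ n * (‖a‖ ^ α * ‖a‖ ^ (-p))) :=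
          le_mul_of_one_le_right (by positivity) hpow
      _ = (δ / 2) ^ n * ‖a‖ ^ n * ω * (κ * (‖a‖ ^ α * ‖a‖ ^ (-p))) := by ring
      _ ≤ _ := by gcongr
  linarith

/-- Interior Hölder estimate on the unit ball, by doubling of variables: at a positive maximum of
`g y - g z - L |y - z|^α - 256 |y - x₀|²` the two equations are compared with displacements that
agree outside `swapRegion` and are opposite inside it. -/
lemma exists_holder_of_unitHarmonic {n : ℕ} {p α : ℝ} (hn : 1 ≤ n) (hα0 : 0 < α) (hα1 : α < 1)
    (hp : n + α ≤ p) (hp2 : p < n + 2) :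
    ∃ L : ℝ, 0 < L ∧ ∀ g : Euc n → ℝ, UnitHarmonic n p g →
      ∀ x₀ ∈ ball (0 : Euc n) (1 / 2), ∀ z₀ ∈ ball (0 : Euc n) (1 / 2),
        g x₀ - g z₀ ≤ L * ‖x₀ - z₀‖ ^ α := by
  have hnp : (n : ℝ) < p := by linarith
  have hp0 : 0 < p := lt_of_le_of_lt (Nat.cast_nonneg n) hnp
  obtain ⟨δ, hδ0, hδ, hgap⟩ := exists_concavity_gap hα0 hα1
  obtain ⟨c, hc0, hc⟩ := exists_swapGain_lower_bound hn hα0 hp hδ0 hδ hgap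
  obtain ⟨T, hT0, hT⟩ := exists_tail_bound hn hnp hp2
  obtain ⟨J, hJ⟩ : ∃ J, J = ∫ w in ball (0 : Euc n) (1 / 16), ‖w‖ ^ 2 * ‖w‖ ^ (-p) := ⟨_, rfl⟩
  have hJ0 : 0 ≤ J := by rw [hJ]; positivity
  obtain ⟨L, hL⟩ : ∃ L, L = 16 + (256 * J + T) / c := ⟨_, rfl⟩
  have hL16 : 16 ≤ L := by
    have : 0 ≤ (256 * J + T) / c := by positivity
    linarith
  have hLc : 256 * J + T < L * c := by
    rw [hL, add_mul, div_mul_cancel₀ _ hc0.ne']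
    linarith
  refine ⟨L, by linarith, fun g hg x₀ hx₀ z₀ hz₀ => ?_⟩
  by_contra! hcon
  have hsub : closedBall (0 : Euc n) (3 / 4) ⊆ ball 0 1 := closedBall_subset_ball (by norm_num)
  have hhalf : ball (0 : Euc n) (1 / 2) ⊆ closedBall 0 (3 / 4) :=
    ball_subset_closedBall.trans (closedBall_subset_closedBall (by norm_num))
  have hgc := hg.continuousOn.mono hsub
  have hcont : ContinuousOn (fun q : Euc n × Euc n =>
      g q.1 - g q.2 - L * ‖q.1 - q.2‖ ^ α - 256 * ‖q.1 - x₀‖ ^ 2)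
      (closedBall (0 : Euc n) (3 / 4) ×ˢ closedBall (0 : Euc n) (3 / 4)) := by
    refine (((hgc.comp continuousOn_fst fun q hq => hq.1).sub
      (hgc.comp continuousOn_snd fun q hq => hq.2)).sub ?_).sub (by fun_prop)
    exact continuousOn_const.mul
      (ContinuousOn.rpow_const (by fun_prop) fun _ _ => Or.inr hα0.le)
  obtain ⟨⟨y, z⟩, ⟨hyK, hzK⟩, hmax⟩ := ((isCompact_closedBall (0 : Euc n) (3 / 4)).prod
    (isCompact_closedBall (0 : Euc n) (3 / 4))).exists_isMaxOn
    ⟨(x₀, z₀), hhalf hx₀, hhalf hz₀⟩ hcont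
  have hmax' : ∀ u ∈ closedBall (0 : Euc n) (3 / 4), ∀ v ∈ closedBall (0 : Euc n) (3 / 4),
      g u - g v - L * ‖u - v‖ ^ α - 256 * ‖u - x₀‖ ^ 2 ≤
        g y - g z - L * ‖y - z‖ ^ α - 256 * ‖y - x₀‖ ^ 2 :=
    fun u hu v hv => hmax (mk_mem_prod hu hv)
  have hyb := hsub hyK
  have hzb := hsub hzK
  have hpos : 0 < g y - g z - L * ‖y - z‖ ^ α - 256 * ‖y - x₀‖ ^ 2 := by
    refine lt_of_lt_of_le ?_ (hmax' x₀ (hhalf hx₀) z₀ (hhalf hz₀))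
    rw [sub_self, norm_zero]
    linarith
  have hgy := hg.le_one y hyb
  have hgz := hg.nonneg z
  have hA0 : 0 ≤ ‖y - z‖ ^ α := by positivity
  have hLA0 : 0 ≤ L * ‖y - z‖ ^ α := by positivity
  have hne : y - z ≠ 0 := by
    intro h
    rw [sub_eq_zero.1 h] at hpos
    have : 0 ≤ ‖z - x₀‖ ^ 2 := by positivity
    rw [sub_self z, norm_zero, Real.zero_rpow hα0.ne'] at hpos
    linarith
  have hyx : ‖y - x₀‖ < 1 / 16 := by nlinarith [norm_nonneg (y - x₀)]
  have hA : ‖y - z‖ < 1 / 16 := by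
    have h1 : ‖y - z‖ ^ α < 1 / 16 := by nlinarith [sq_nonneg ‖y - x₀‖]
    have h2 : (1 / 16 : ℝ) ≤ (1 / 16) ^ α := by
      conv_lhs => rw [← Real.rpow_one (1 / 16 : ℝ)]
      exact Real.rpow_le_rpow_of_exponent_ge (by norm_num) (by norm_num) hα1.le
    exact (Real.rpow_lt_rpow_iff (norm_nonneg _) (by norm_num) hα0).1 (h1.trans_le h2)
  have hy916 : ‖y‖ < 9 / 16 := by
    have h1 := norm_add_le (y - x₀) x₀
    rw [sub_add_cancel] at h1
    rw [mem_ball_zero_iff] at hx₀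
    linarith
  have hz58 : ‖z‖ < 5 / 8 := by
    have h1 := norm_sub_le y (y - z)
    rw [sub_sub_cancel] at h1
    linarith
  have hyw : ∀ w : Euc n, ‖w‖ ≤ 1 / 16 → y + w ∈ closedBall (0 : Euc n) (3 / 4) := by
    intro w hw
    rw [mem_closedBall_zero_iff]
    linarith [norm_add_le y w]
  have hzw : ∀ w : Euc n, ‖w‖ ≤ 1 / 16 → z + w ∈ closedBall (0 : Euc n) (3 / 4) := by
    intro w hw
    rw [mem_closedBall_zero_iff]
    linarith [norm_add_le z w]
  have hTy := hT g hg y (mem_ball_zero_iff.2 hy916)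
  set a := y - z with ha
  have hA1 : 0 < ‖a‖ := norm_pos_iff.2 hne
  have hgain := hc a hne (by linarith)
  have hlim : L * c - 256 * J - T ≤ 0 := by
    have hlim0 := (hg.tendsto y hyb).sub (hg.tendsto z hzb)
    rw [sub_zero] at hlim0
    refine ge_of_tendsto hlim0 ?_
    filter_upwards [Ioo_mem_nhdsGT (show (0 : ℝ) < ‖a‖ / 4 by positivity)] with ε hε
    have hD := measurableSet_swapRegion δ a
    have hDS : swapRegion δ a ⊆ (ball (0 : Euc n) ε)ᶜ := fun w hw =>
      mem_compl_ball_zero.2 (hε.2.le.trans (norm_bounds_of_mem_swapRegion hδ hw).1)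
    have hB := (measurableSet_ball (x := (0 : Euc n)) (ε := 1 / 16)).compl
    have hS := (measurableSet_ball (x := (0 : Euc n)) (ε := ε)).compl
    set Fz : Euc n → ℝ := fun w => (g z - g (z + w)) * ‖w‖ ^ (-p) with hFz
    set P : Euc n → ℝ := (swapRegion δ a).indicator fun w => Fz (-w) - Fz w with hP
    have iy := hg.integrableOn_sub hnp hyb hε.1
    have iz : IntegrableOn Fz (ball (0 : Euc n) ε)ᶜ := hg.integrableOn_sub hnp hzb hε.1
    have iP : Integrable P := by
      have h1 := (iz.mono_set hDS).integrable_indicator hD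
      have h2 := h1.comp_neg
      simp only [indicator_swapRegion_neg] at h2
      refine (h2.sub h1).congr (Eventually.of_forall fun w => ?_)
      simp only [hP, Pi.sub_apply, indicator]
      split_ifs <;> simp
    have hP0 : ∫ w in (ball (0 : Euc n) ε)ᶜ, P w = 0 := by
      rw [hP, setIntegral_indicator hD, inter_eq_right.2 hDS, ← integral_indicator hD]
      refine integral_eq_zero_of_odd fun w => ?_
      rw [indicator_swapRegion_neg]
      simp only [indicator, neg_neg]
      split_ifs <;> ring
    have ig := ((integrableOn_swapGain (p := p) hα0 hnp hδ hne).integrable_indicator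
      hD).integrableOn (s := (ball (0 : Euc n) ε)ᶜ)
    have iq := integrableOn_quadInc (1 / 16) hnp hε.1 (y - x₀)
    have it := (hg.integrableOn y hyb ε hε.1).indicator hB
    have hle := setIntegral_mono_on (((ig.const_mul L).sub (iq.const_mul 256)).sub it)
      ((iy.sub iz).sub iP.integrableOn) hS (fun w _ => ?_)
    · simp only [Pi.sub_apply] at hle
      rw [integral_sub (f := fun w => L * (swapRegion δ a).indicator (swapGain α p a) w -
          256 * quadInc p (1 / 16) (y - x₀) w) ((ig.const_mul L).sub (iq.const_mul 256)) it,
        integral_sub (ig.const_mul L) (iq.const_mul 256), integral_const_mul, integral_const_mul,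
        integral_sub (f := fun w => (g y - g (y + w)) * ‖w‖ ^ (-p) - Fz w) (iy.sub iz)
          iP.integrableOn, integral_sub iy iz, hP0, sub_zero,
        setIntegral_indicator hB, setIntegral_indicator hD, inter_eq_right.2 hDS,
        compl_ball_inter_of_le (show ε ≤ 1 / 16 by linarith [hε.2])] at hle
      have hJq := integral_quadInc_le hn hnp hp2 hε.1 (show (0 : ℝ) < 1 / 16 by norm_num)
        (y - x₀)
      rw [← hJ] at hJq
      have hLg : L * c ≤ L * ∫ w in swapRegion δ a, swapGain α p a w := by gcongr
      linarith
    · have hk : 0 ≤ ‖w‖ ^ (-p) := by positivity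
      have hsq := norm_add_sq_real (y - x₀) w
      rw [show y - x₀ + w = y + w - x₀ by abel] at hsq
      by_cases hwD : w ∈ swapRegion δ a
      · have hw : ‖w‖ < 1 / 16 := (norm_bounds_of_mem_swapRegion hδ hwD).2.trans_lt hA
        have h1 := hmax' (y + w) (hyw w hw.le) (z + -w) (hzw (-w) (by rw [norm_neg]; exact hw.le))
        rw [show y + w - (z + -w) = a + (2 : ℝ) • w by rw [ha]; module, hsq] at h1
        have h2 : L * (‖a‖ ^ α - ‖a + (2 : ℝ) • w‖ ^ α) -
            256 * (2 * ⟪y - x₀, w⟫ + ‖w‖ ^ 2) ≤ (g y - g (y + w)) - (g z - g (z + -w)) := by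
          linarith
        have h3 := mul_le_mul_of_nonneg_right h2 hk
        simp only [Pi.sub_apply, hP, hwD, hFz, norm_neg, swapGain, quadInc,
          indicator, mem_compl_iff, mem_ball_zero_iff, hw, not_true, if_true, if_false]
        linarith
      · simp only [Pi.sub_apply, hP, indicator_of_notMem hwD, hFz, quadInc]
        simp only [indicator, mem_compl_iff, mem_ball_zero_iff]
        by_cases hw : ‖w‖ < 1 / 16
        · have h1 := hmax' (y + w) (hyw w hw.le) (z + w) (hzw w hw.le)
          rw [add_sub_add_right_eq_sub, hsq] at h1
          have h2 : -(256 * (2 * ⟪y - x₀, w⟫ + ‖w‖ ^ 2)) ≤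
              (g y - g (y + w)) - (g z - g (z + w)) := by linarith
          have h3 := mul_le_mul_of_nonneg_right h2 hk
          simp only [hw, not_true, if_true, if_false]
          linarith
        · have h1 := hg.nonneg (z + w)
          have h2 : -g (y + w) ≤ (g y - g (y + w)) - (g z - g (z + w)) := by
            linarith [sq_nonneg ‖y - x₀‖]
          have h3 := mul_le_mul_of_nonneg_right h2 hk
          simp only [hw, not_false_eq_true, if_true, if_false]
          linarith
  linarith

lemma C11LocOn.continuousOn {n : ℕ} {u : Euc n → ℝ} {Ω : Set (Euc n)} (hu : C11LocOn n u Ω) :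
    ContinuousOn u Ω := by
  intro x hx
  obtain ⟨ε, hε, -, hc, -⟩ := hu x hx
  exact (hc.continuousOn.continuousAt (ball_mem_nhds x hε)).continuousWithinAt

lemma fracC_pos {n : ℕ} {s : ℝ} (hs0 : 0 < s) (hs1 : s < 1) : 0 < fracC n s := by
  have h1 : 0 < Real.Gamma ((n : ℝ) / 2 + s) := Real.Gamma_pos_of_pos (by positivity)
  have h2 : 0 < Real.Gamma (1 - s) := Real.Gamma_pos_of_pos (by linarith)
  have h3 := Real.pi_pos
  unfold fracC
  positivity

/-- A function in the tail space is integrable against the kernel centred at any point, away from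
that point. -/
lemma MemL2s.integrableOn_kernel {n : ℕ} {s : ℝ} {h : Euc n → ℝ} (hh : MemL2s n s h)
    (hs0 : 0 < s) (X : Euc n) {ε : ℝ} (hε : 0 < ε) :
    IntegrableOn (fun w => h (X + w) * ‖w‖ ^ (-((n : ℝ) + 2 * s))) (ball (0 : Euc n) ε)ᶜ := by
  set p := (n : ℝ) + 2 * s with hp
  have hp0 : 0 < p := by positivity
  have hm : AEStronglyMeasurable (fun w => h (X + w)) volume :=
    hh.1.aestronglyMeasurable.comp_measurePreserving (measurePreserving_add_left volume X)
  have hi : Integrable (fun w => |h (X + w)| / (1 + ‖X + w‖ ^ p)) := hh.2.comp_add_left X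
  refine Integrable.mono' (hi.const_mul ((1 / ε) ^ p + (1 + ‖X‖ / ε) ^ p)).integrableOn
    (hm.restrict.mul (Measurable.aestronglyMeasurable (by fun_prop))) ?_
  filter_upwards [ae_restrict_mem measurableSet_ball.compl] with w hw
  rw [mem_compl_ball_zero] at hw
  have hw0 : 0 < ‖w‖ := hε.trans_le hw
  have h1 : 1 ≤ (1 / ε) ^ p * ‖w‖ ^ p := by
    rw [← Real.mul_rpow (by positivity) hw0.le]
    refine Real.one_le_rpow ?_ hp0.le
    rw [div_mul_eq_mul_div, le_div_iff₀ hε]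
    linarith
  have h2 : ‖X + w‖ ^ p ≤ (1 + ‖X‖ / ε) ^ p * ‖w‖ ^ p := by
    rw [← Real.mul_rpow (by positivity) hw0.le]
    refine Real.rpow_le_rpow (norm_nonneg _) ?_ hp0.le
    have h3 : ‖X‖ ≤ ‖X‖ / ε * ‖w‖ := by
      rw [div_mul_eq_mul_div, le_div_iff₀ hε]
      gcongr
    linarith [norm_add_le X w]
  rw [norm_mul, Real.norm_eq_abs, Real.norm_of_nonneg (by positivity), Real.rpow_neg hw0.le,
    ← div_eq_mul_inv, mul_div_assoc', div_le_div_iff₀ (by positivity) (by positivity)]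
  have h4 : 1 + ‖X + w‖ ^ p ≤ ((1 / ε) ^ p + (1 + ‖X‖ / ε) ^ p) * ‖w‖ ^ p := by linarith
  nlinarith [mul_le_mul_of_nonneg_left h4 (abs_nonneg (h (X + w)))]

/-- Rescaling the ball `B_r(x)` to the unit ball and dividing by a bound `N`. -/
lemma unitHarmonic_rescale {n : ℕ} {s r N : ℝ} (hs0 : 0 < s) (hs1 : s < 1) (hr : 0 < r)
    (hN : 0 < N) {x : Euc n} {h : Euc n → ℝ} (h0 : ∀ y, 0 ≤ h y) (hc : ContinuousOn h (ball x r))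
    (hL : MemL2s n s h) (hlap : ∀ y ∈ ball x r, HasFracLapAt n s h y 0)
    (hle : ∀ y ∈ ball x r, h y ≤ N) :
    UnitHarmonic n ((n : ℝ) + 2 * s) (fun y => N⁻¹ * h (x + r • y)) := by
  set p := (n : ℝ) + 2 * s with hp
  have hmem : ∀ y ∈ ball (0 : Euc n) 1, x + r • y ∈ ball x r := by
    intro y hy
    rw [mem_ball_zero_iff] at hy
    rw [mem_ball_iff_norm, add_sub_cancel_left, norm_smul, Real.norm_of_nonneg hr.le]
    nlinarith
  have hrp : r ^ p * r ^ (-p) = 1 := by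
    rw [← Real.rpow_add hr]; simp
  have hscale : ∀ ε : ℝ, ∀ w : Euc n, r • w ∈ (ball (0 : Euc n) (r * ε))ᶜ ↔
      w ∈ (ball (0 : Euc n) ε)ᶜ := by
    intro ε w
    rw [mem_compl_ball_zero, mem_compl_ball_zero, norm_smul, Real.norm_of_nonneg hr.le,
      mul_le_mul_iff_right₀ hr]
  have hker : ∀ w : Euc n, ‖w‖ ^ (-p) = r ^ p * ‖r • w‖ ^ (-p) := by
    intro w
    rw [norm_smul, Real.norm_of_nonneg hr.le, Real.mul_rpow hr.le (norm_nonneg _), ← mul_assoc,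
      hrp, one_mul]
  refine ⟨fun y => by have := h0 (x + r • y); positivity, ?_, fun y hy => ?_, fun y hy ε hε => ?_,
    fun y hy => ?_⟩
  · exact continuousOn_const.mul (hc.comp (by fun_prop) hmem)
  · rw [inv_mul_le_iff₀ hN, mul_one]
    exact hle _ (hmem y hy)
  · have hi := hL.integrableOn_kernel hs0 (x + r • y) (mul_pos hr hε)
    rw [← hp, ← integrable_indicator_iff measurableSet_ball.compl,
      ← integrable_comp_smul_iff volume _ hr.ne'] at hi
    rw [← integrable_indicator_iff measurableSet_ball.compl]
    refine (hi.const_mul (N⁻¹ * r ^ p)).congr (Eventually.of_forall fun w => ?_)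
    by_cases hw : w ∈ (ball (0 : Euc n) ε)ᶜ
    · simp only [indicator_of_mem hw, indicator_of_mem ((hscale ε w).2 hw)]
      rw [hker w, smul_add, add_assoc]
      ring
    · simp only [indicator_of_notMem hw, indicator_of_notMem (fun h => hw ((hscale ε w).1 h)),
        mul_zero]
  · have hX := hlap _ (hmem y hy)
    set X := x + r • y with hXdef
    have hC := fracC_pos (n := n) hs0 hs1
    have hcomp : Tendsto (fun ε : ℝ => r * ε) (𝓝[>] 0) (𝓝[>] 0) := by
      refine tendsto_nhdsWithin_iff.2 ⟨?_, ?_⟩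
      · have : Tendsto (fun ε : ℝ => r * ε) (𝓝 0) (𝓝 (r * 0)) :=
          (continuous_const_mul r).tendsto 0
        rw [mul_zero] at this
        exact this.mono_left nhdsWithin_le_nhds
      · filter_upwards [self_mem_nhdsWithin] with ε hε
        exact mul_pos hr hε
    have hlim := (hX.comp hcomp).const_mul (N⁻¹ * r ^ p * |(r ^ n)⁻¹| * (fracC n s)⁻¹)
    rw [mul_zero] at hlim
    refine hlim.congr fun ε => ?_
    have hset : {u : Euc n | r * ε ≤ dist X u} = (ball X (r * ε))ᶜ := by
      ext u
      simp [dist_comm]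
    simp only [Function.comp_apply]
    rw [hset, ← integral_indicator measurableSet_ball.compl,
      ← integral_indicator measurableSet_ball.compl, ← integral_add_left_eq_self _ X]
    have hcs := Measure.integral_comp_smul (volume : Measure (Euc n)) (fun u =>
      (ball X (r * ε))ᶜ.indicator (fun u => (h X - h u) / dist X u ^ p) (X + u)) r
    rw [finrank_euclideanSpace, Fintype.card_fin, smul_eq_mul] at hcs
    rw [← mul_assoc, mul_assoc _ _ (fracC n s), inv_mul_cancel₀ hC.ne', mul_one, mul_assoc, ← hcs,
      ← integral_const_mul]
    refine integral_congr_ae (Eventually.of_forall fun w => ?_)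
    have hiff : X + r • w ∈ (ball X (r * ε))ᶜ ↔ w ∈ (ball (0 : Euc n) ε)ᶜ := by
      rw [← hscale]
      simp [dist_eq_norm]
    by_cases hw : w ∈ (ball (0 : Euc n) ε)ᶜ
    · simp only [indicator_of_mem hw, indicator_of_mem (hiff.2 hw)]
      rw [hker w, smul_add, ← add_assoc, ← hXdef, dist_self_add_right, Real.rpow_neg (norm_nonneg _)]
      ring
    · simp only [indicator_of_notMem hw, indicator_of_notMem (fun h => hw (hiff.1 h)), mul_zero]

/-- scaled interior Hölder seminorm estimate for `s`-harmonic functions: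
if `h ∈ C^{1,1}_{loc}(B_r(x)) ∩ L_{2s}` is nonnegative on `ℝⁿ` and `(-Δ)^s h = 0` in
`B_r(x)` with `0 < r ≤ 1`, then `[h]_{C^α(B_{r/2}(x))} ≤ C r^{-α} ‖h‖_{L^∞(B_r(x))}`
for `α ∈ (0, min(2s,1))`, with `C = C(n,s,α)`. -/
theorem scaled_interior_holder
    (n : ℕ) (hn : 1 ≤ n) (s α : ℝ) (hs0 : 0 < s) (hs1 : s < 1)
    (hα0 : 0 < α) (hα1 : α < min (2 * s) 1) :
    ∃ C : ℝ, 0 < C ∧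
      ∀ (r : ℝ), 0 < r → r ≤ 1 → ∀ (x : Euc n) (h : Euc n → ℝ) (N : ℝ),
        (∀ y, 0 ≤ h y) → C11LocOn n h (ball x r) → MemL2s n s h →
        (∀ y ∈ ball x r, HasFracLapAt n s h y 0) →
        (∀ y ∈ ball x r, h y ≤ N) →
        ∀ y ∈ ball x (r/2), ∀ z ∈ ball x (r/2),
          |h y - h z| ≤ C * r ^ (-α) * N * dist y z ^ α := by
  obtain ⟨hα2, hα3⟩ := lt_min_iff.1 hα1
  obtain ⟨L, hL0, hL⟩ := exists_holder_of_unitHarmonic (n := n) (p := (n : ℝ) + 2 * s) hn hα0 hα3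
    (by linarith) (by linarith)
  refine ⟨L, hL0, fun r hr _ x h N h0 hC hM hlap hle y hy z hz => ?_⟩
  have hN0 : 0 ≤ N := (h0 x).trans (hle x (mem_ball_self hr))
  have hsub : ball x (r / 2) ⊆ ball x r := ball_subset_ball (by linarith)
  rcases hN0.eq_or_lt with hN | hN
  · have h1 := le_antisymm (hN ▸ hle y (hsub hy)) (h0 y)
    have h2 := le_antisymm (hN ▸ hle z (hsub hz)) (h0 z)
    rw [h1, h2, ← hN]
    simp
  have hg := unitHarmonic_rescale hs0 hs1 hr hN h0 hC.continuousOn hM hlap hle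
  have hmem : ∀ u ∈ ball x (r / 2), r⁻¹ • (u - x) ∈ ball (0 : Euc n) (1 / 2) := by
    intro u hu
    rw [mem_ball_iff_norm] at hu
    rw [mem_ball_zero_iff, norm_smul, norm_inv, Real.norm_of_nonneg hr.le, inv_mul_lt_iff₀ hr]
    linarith
  have key : ∀ u ∈ ball x (r / 2), ∀ v ∈ ball x (r / 2),
      h u - h v ≤ L * r ^ (-α) * N * dist u v ^ α := by
    intro u hu v hv
    have h1 := hL _ hg _ (hmem u hu) _ (hmem v hv)
    rw [smul_inv_smul₀ hr.ne', smul_inv_smul₀ hr.ne', add_sub_cancel, add_sub_cancel, ← smul_sub,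
      sub_sub_sub_cancel_right, norm_smul, norm_inv, Real.norm_of_nonneg hr.le,
      Real.mul_rpow (by positivity) (norm_nonneg _), Real.inv_rpow hr.le, ← Real.rpow_neg hr.le,
      ← dist_eq_norm, ← mul_sub, inv_mul_le_iff₀ hN] at h1
    linarith
  rw [abs_le]
  have h1 := key y hy z hz
  have h2 := key z hz y hy
  rw [dist_comm z y] at h2
  constructor <;> linarith
end
end

section
/- Let n ≥ 1, s ∈ (0,1), p > 1 and R > 0. Let x̄ ∈ ℝⁿ and let u be a nonnegative continuous function on the closed ball with center x̄ and radius r := 2R·u(x̄)^{−(p−1)/(2s)}, where u(x̄) > 0. Then there exists a ∈ B_r(x̄) at which the function S(x) := u(x)(r − |x − x̄|)^{2s/(p−1)} attains its maximum over the closed ball. Moreover, setting λ := u(a)^{−(p−1)/(2s)}, one has: u(x̄) ≤ u(a); 2Rλ ≤ r − |a − x̄|; B_{Rλ}(a) ⊂ B_r(x̄); and u(x) ≤ 2^{2s/(p−1)} u(a) for every x ∈ B_{Rλ}(a). -/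
open MeasureTheory Metric Set Filter
open scoped Topology NNReal ENNReal RealInnerProductSpace

noncomputable section

/-- point selection / doubling step of the blow-up argument: for a
nonnegative continuous `u` on the closed ball of radius `r = 2R·u(x̄)^{-(p-1)/(2s)}` around
`x̄`, with `u(x̄) > 0`, the function `S(x) = u(x)(r - |x - x̄|)^{2s/(p-1)}` attains its
maximum over the closed ball at some `a ∈ B_r(x̄)`, and with `λ = u(a)^{-(p-1)/(2s)}` one
has `u(x̄) ≤ u(a)`, `2Rλ ≤ r - |a - x̄|`, `B_{Rλ}(a) ⊆ B_r(x̄)`, and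
`u ≤ 2^{2s/(p-1)} u(a)` on `B_{Rλ}(a)`. -/
theorem point_selection
    (n : ℕ) (hn : 1 ≤ n) (s p R : ℝ) (hs0 : 0 < s) (hs1 : s < 1) (hp : 1 < p) (hR : 0 < R)
    (xb : Euc n) (u : Euc n → ℝ) (hub : 0 < u xb)
    (r : ℝ) (hr : r = 2 * R * u xb ^ (-(p - 1) / (2 * s)))
    (hcont : ContinuousOn u (closedBall xb r))
    (hnonneg : ∀ x ∈ closedBall xb r, 0 ≤ u x) :
    ∃ a ∈ ball xb r,
      IsMaxOn (fun x => u x * (r - dist x xb) ^ (2 * s / (p - 1))) (closedBall xb r) a ∧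
      u xb ≤ u a ∧
      2 * R * u a ^ (-(p - 1) / (2 * s)) ≤ r - dist a xb ∧
      ball a (R * u a ^ (-(p - 1) / (2 * s))) ⊆ ball xb r ∧
      ∀ x ∈ ball a (R * u a ^ (-(p - 1) / (2 * s))),
        u x ≤ (2 : ℝ) ^ (2 * s / (p - 1)) * u a := by
  have hσ : 0 < 2 * s / (p - 1) := div_pos (by linarith) (by linarith)
  have he : -(p - 1) / (2 * s) = -(2 * s / (p - 1))⁻¹ := by rw [inv_div, neg_div]
  rw [he] at hr ⊢
  generalize 2 * s / (p - 1) = σ at hσ hr ⊢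
  have hr0 : 0 < r := by rw [hr]; positivity
  have hxb : xb ∈ closedBall xb r := mem_closedBall_self hr0.le
  obtain ⟨a, ha, hmax⟩ := (isCompact_closedBall xb r).exists_isMaxOn ⟨xb, hxb⟩
    (f := fun x => u x * (r - dist x xb) ^ σ)
    (hcont.mul ((by fun_prop : Continuous fun x => r - dist x xb).continuousOn.rpow_const
      fun _ _ => Or.inr hσ.le))
  have hS : ∀ x ∈ closedBall xb r,
      u x * (r - dist x xb) ^ σ ≤ u a * (r - dist a xb) ^ σ := fun x hx => hmax hx
  have hcenter : u xb * r ^ σ = (2 * R) ^ σ := by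
    rw [hr, Real.mul_rpow (by positivity) (by positivity), ← Real.rpow_mul hub.le, neg_mul,
      inv_mul_cancel₀ hσ.ne', Real.rpow_neg_one]
    field_simp
  have hSa : u xb * r ^ σ ≤ u a * (r - dist a xb) ^ σ := by simpa using hS xb hxb
  have hSpos : 0 < u a * (r - dist a xb) ^ σ := lt_of_lt_of_le (by positivity) hSa
  have hua0 := hnonneg a ha
  have hd0 : 0 ≤ r - dist a xb := sub_nonneg.2 (mem_closedBall.1 ha)
  have hua : 0 < u a := hua0.lt_of_ne fun h => by simp [← h] at hSpos
  have hd : 0 < r - dist a xb :=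
    hd0.lt_of_ne fun h => by simp [← h, Real.zero_rpow hσ.ne'] at hSpos
  have hle : u xb ≤ u a := by
    have h : (r - dist a xb) ^ σ ≤ r ^ σ :=
      Real.rpow_le_rpow hd0 (by linarith [dist_nonneg (x := a) (y := xb)]) hσ.le
    exact le_of_mul_le_mul_right (hSa.trans (mul_le_mul_of_nonneg_left h hua0)) (by positivity)
  have hdist : 2 * R * u a ^ (-σ⁻¹) ≤ r - dist a xb := by
    rw [← Real.rpow_le_rpow_iff (by positivity) hd0 hσ, Real.mul_rpow (by positivity)
      (by positivity), ← Real.rpow_mul hua0, neg_mul, inv_mul_cancel₀ hσ.ne',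
      Real.rpow_neg_one, ← div_eq_mul_inv, div_le_iff₀ hua, ← hcenter, mul_comm _ (u a)]
    exact hSa
  have hhalf : ∀ x ∈ ball a (R * u a ^ (-σ⁻¹)), (r - dist a xb) / 2 < r - dist x xb := by
    intro x hx
    linarith [dist_triangle x a xb, mem_ball.1 hx]
  have hsub : ball a (R * u a ^ (-σ⁻¹)) ⊆ ball xb r := fun x hx => by
    rw [mem_ball]
    linarith [hhalf x hx]
  refine ⟨a, by rw [mem_ball]; linarith, hmax, hle, hdist, hsub, fun x hx => ?_⟩
  have hxr := ball_subset_closedBall (hsub hx)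
  have h : ((r - dist a xb) / 2) ^ σ ≤ (r - dist x xb) ^ σ :=
    Real.rpow_le_rpow (by positivity) (hhalf x hx).le hσ.le
  have h' := (mul_le_mul_of_nonneg_left h (hnonneg x hxr)).trans (hS x hxr)
  rw [Real.div_rpow hd0 zero_le_two, ← mul_div_assoc, div_le_iff₀ (by positivity)] at h'
  refine le_of_mul_le_mul_right (h'.trans_eq ?_) (Real.rpow_pos_of_pos hd σ)
  ring
end
end

section
/- Let n ≥ 1 and s ∈ (0,1) with n > 2s. For x, y ∈ ℝⁿ_+ := {z ∈ ℝⁿ : z_n > 0} with x ≠ y, let G_∞(x,y) = C_{n,s} |x−y|^{2s−n} ∫₀^{4 x_n y_n / |x−y|²} t^{s−1} (1+t)^{−n/2} dt, where C_{n,s} > 0 is a constant (this is the Green function of (-Δ)^s on the half-space ℝⁿ_+). Then for every fixed x ∈ ℝⁿ_+, ∫_{ℝⁿ_+} G_∞(x,y) dy = +∞. -/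
open MeasureTheory Metric Set Filter
open scoped Topology NNReal ENNReal RealInnerProductSpace

noncomputable section

/-- The Green function of `(-Δ)^s` on the half-space `ℝⁿ_+` (with `n = m+1`), with
normalization constant `Cns`:
`G_∞(x,y) = Cns · |x-y|^{2s-n} ∫₀^{4xₙyₙ/|x-y|²} t^{s-1} (1+t)^{-n/2} dt`. -/
def greenHalf (m : ℕ) (s Cns : ℝ) (x y : Euc (m + 1)) : ℝ :=
  Cns * dist x y ^ (2 * s - ((m : ℝ) + 1)) *
    ∫ t in Ioo (0 : ℝ) (4 * x (Fin.last m) * y (Fin.last m) / dist x y ^ 2),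
      t ^ (s - 1) * (1 + t) ^ (-((m : ℝ) + 1) / 2)

/-- The integrand `t^(s-1) (1+t)^q` of the Green function is integrable near `0`. -/
lemma integrableOn_rpow_mul_one_add_rpow {s q : ℝ} (hs : 0 < s) (hq : q ≤ 0) (T : ℝ) :
    IntegrableOn (fun t : ℝ => t ^ (s - 1) * (1 + t) ^ q) (Ioo 0 T) := by
  rcases le_total T 0 with hT | hT
  · simp [Ioo_eq_empty (not_lt.mpr hT)]
  have h : IntegrableOn (fun t : ℝ => t ^ (s - 1)) (Ioo 0 T) :=
    ((intervalIntegrable_iff_integrableOn_Ioo_of_le hT).mp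
      (intervalIntegral.intervalIntegrable_rpow' (by linarith)))
  refine Integrable.mono h (by fun_prop) ?_
  filter_upwards [ae_restrict_mem measurableSet_Ioo] with t ht
  rw [norm_mul]
  refine mul_le_of_le_one_right (norm_nonneg _) ?_
  rw [Real.norm_of_nonneg (Real.rpow_nonneg (by linarith [ht.1]) _)]
  exact Real.rpow_le_one_of_one_le_of_nonpos (by linarith [ht.1]) hq

/-- Lower bound for the truncated integral in the Green function. -/
lemma rpow_mul_two_rpow_le_setIntegral {s q τ T : ℝ} (hs0 : 0 < s) (hs1 : s < 1) (hq : q ≤ 0)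
    (hτ0 : 0 < τ) (hτ1 : τ ≤ 1) (hτT : τ ≤ T) :
    τ ^ s * 2 ^ q ≤ ∫ t in Ioo (0 : ℝ) T, t ^ (s - 1) * (1 + t) ^ q := by
  have hint := integrableOn_rpow_mul_one_add_rpow hs0 hq T
  have hsub : Ioo (0 : ℝ) τ ⊆ Ioo 0 T := Ioo_subset_Ioo_right hτT
  calc τ ^ s * 2 ^ q = ∫ _ in Ioo (0 : ℝ) τ, τ ^ (s - 1) * (2 : ℝ) ^ q := by
        rw [setIntegral_const, Real.volume_real_Ioo_of_le hτ0.le, Real.rpow_sub_one hτ0.ne']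
        simp only [smul_eq_mul]
        field_simp
        ring
    _ ≤ ∫ t in Ioo (0 : ℝ) τ, t ^ (s - 1) * (1 + t) ^ q := by
        refine setIntegral_mono_on (integrableOn_const (by simp)) (hint.mono_set hsub) measurableSet_Ioo
          fun t ht => ?_
        have ht0 : 0 < t := ht.1
        exact mul_le_mul
          (Real.rpow_le_rpow_of_nonpos ht0 ht.2.le (by linarith))
          (Real.rpow_le_rpow_of_nonpos (by linarith) (by linarith [ht.2]) hq)
          (by positivity) (by positivity)
    _ ≤ ∫ t in Ioo (0 : ℝ) T, t ^ (s - 1) * (1 + t) ^ q := by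
        refine setIntegral_mono_set hint ?_ hsub.eventuallyLE
        filter_upwards [ae_restrict_mem measurableSet_Ioo] with t ht
        have ht0 : 0 < t := ht.1
        simp only [Pi.zero_apply]
        positivity

/-- Points of the ball of radius `R` about `x + 2R eₙ` lie at height at least `R` above `x` and
at distance between `R` and `3R` from `x`. -/
lemma mem_ball_add_single_bounds {m : ℕ} {x y : Euc (m + 1)} {R : ℝ} (hR : 0 < R)
    (hy : y ∈ ball (x + EuclideanSpace.single (Fin.last m) (2 * R)) R) :
    x (Fin.last m) + R < y (Fin.last m) ∧ R < dist x y ∧ dist x y < 3 * R := by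
  set e : Euc (m + 1) := EuclideanSpace.single (Fin.last m) (2 * R) with he
  have hd : dist y (x + e) < R := hy
  have hxe : dist x (x + e) = 2 * R := by
    simp [he, abs_of_pos hR]
  have hcoord : |y (Fin.last m) - (x (Fin.last m) + 2 * R)| < R := by
    have h := PiLp.norm_apply_le (y - (x + e)) (Fin.last m)
    rw [← dist_eq_norm] at h
    simp only [PiLp.sub_apply, PiLp.add_apply, he, PiLp.single_apply, Real.norm_eq_abs,
      if_true] at h
    exact h.trans_lt hd
  refine ⟨by linarith [(abs_lt.mp hcoord).1], ?_, ?_⟩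
  · linarith [dist_triangle x y (x + e)]
  · linarith [dist_triangle_right x y (x + e)]

/-- Lower bound for the Green function on the ball of radius `R` about `x + 2R eₙ`. -/
lemma le_greenHalf_of_mem_ball {m : ℕ} {s Cns R : ℝ} (hs0 : 0 < s) (hs1 : s < 1)
    (hns : 2 * s < (m : ℝ) + 1) (hC : 0 < Cns) {x y : Euc (m + 1)} (hx : 0 < x (Fin.last m))
    (hR : x (Fin.last m) ≤ R)
    (hy : y ∈ ball (x + EuclideanSpace.single (Fin.last m) (2 * R)) R) :
    Cns * (3 * R) ^ (2 * s - ((m : ℝ) + 1)) *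
      ((4 * x (Fin.last m) / 9 / R) ^ s * 2 ^ (-((m : ℝ) + 1) / 2)) ≤ greenHalf m s Cns x y := by
  have hR0 : 0 < R := hx.trans_le hR
  obtain ⟨hh, hd1, hd2⟩ := mem_ball_add_single_bounds hR0 hy
  have hd0 : 0 < dist x y := hR0.trans hd1
  have hm : (0 : ℝ) ≤ m := m.cast_nonneg
  refine mul_le_mul (mul_le_mul_of_nonneg_left
    (Real.rpow_le_rpow_of_nonpos hd0 hd2.le (by linarith)) hC.le)
    (rpow_mul_two_rpow_le_setIntegral hs0 hs1 (by linarith) (by positivity) ?_ ?_)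
    (by positivity) (by positivity)
  · rw [div_le_one hR0]
    linarith
  · rw [div_div, div_le_div_iff₀ (by positivity) (by positivity)]
    have h1 : dist x y ^ 2 ≤ 9 * R * y (Fin.last m) := by
      nlinarith
    nlinarith

/-- divergence of the half-space Green function integral: with
`n = m + 1` and `n > 2s`, for every normalization constant `Cns > 0` and every
`x ∈ ℝⁿ_+`, the integral `∫_{ℝⁿ_+} G_∞(x,y) dy` diverges. -/
theorem green_halfspace_integral_diverges
    (m : ℕ) (s : ℝ) (hs0 : 0 < s) (hs1 : s < 1) (hns : 2 * s < (m : ℝ) + 1)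
    (Cns : ℝ) (hC : 0 < Cns)
    (x : Euc (m + 1)) (hx : 0 < x (Fin.last m)) :
    ∫⁻ y in {y : Euc (m + 1) | 0 < y (Fin.last m)},
      ENNReal.ofReal (greenHalf m s Cns x y) = ⊤ := by
  set a := x (Fin.last m) with ha
  set v : ℝ := (volume (ball (0 : Euc (m + 1)) 1)).toReal with hv
  have hv0 : 0 < v :=
    ENNReal.toReal_pos (measure_ball_pos _ _ one_pos).ne' measure_ball_lt_top.ne
  set K : ℝ := Cns * 3 ^ (2 * s - ((m : ℝ) + 1)) *
    ((4 * a / 9) ^ s * 2 ^ (-((m : ℝ) + 1) / 2)) * v with hK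
  have hK0 : 0 < K := by positivity
  have hlim : Tendsto (fun R : ℝ => ENNReal.ofReal (K * R ^ s)) atTop (𝓝 ⊤) :=
    ENNReal.tendsto_ofReal_atTop.comp ((tendsto_rpow_atTop hs0).const_mul_atTop hK0)
  refine top_le_iff.mp (le_of_tendsto hlim ?_)
  filter_upwards [eventually_ge_atTop a] with R hR
  have hR0 : 0 < R := hx.trans_le hR
  set B := ball (x + EuclideanSpace.single (Fin.last m) (2 * R)) R with hB
  set L : ℝ := Cns * (3 * R) ^ (2 * s - ((m : ℝ) + 1)) *
    ((4 * a / 9 / R) ^ s * 2 ^ (-((m : ℝ) + 1) / 2)) with hL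
  have hL0 : 0 ≤ L := by positivity
  have hvol : volume B = ENNReal.ofReal (R ^ (m + 1) * v) := by
    rw [hB, Measure.addHaar_ball _ _ hR0.le, ENNReal.ofReal_mul (by positivity), hv,
      ENNReal.ofReal_toReal measure_ball_lt_top.ne, finrank_euclideanSpace_fin]
  have hscale : K * R ^ s = L * (R ^ (m + 1) * v) := by
    have hpow : R ^ (2 * s - ((m : ℝ) + 1)) * R ^ (m + 1) = R ^ s * R ^ s := by
      rw [← Real.rpow_natCast, ← Real.rpow_add hR0, ← Real.rpow_add hR0]
      congr 1
      push_cast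
      ring
    have hRs : R ^ s ≠ 0 := by positivity
    rw [hK, hL, Real.mul_rpow (by norm_num) hR0.le, Real.div_rpow (by positivity) hR0.le]
    field_simp
    linear_combination -hpow
  calc ENNReal.ofReal (K * R ^ s) = ENNReal.ofReal L * volume B := by
        rw [hscale, ENNReal.ofReal_mul hL0, hvol]
    _ = ∫⁻ _ in B, ENNReal.ofReal L := (setLIntegral_const _ _).symm
    _ ≤ ∫⁻ y in B, ENNReal.ofReal (greenHalf m s Cns x y) :=
        setLIntegral_mono' measurableSet_ball fun y hy =>
          ENNReal.ofReal_le_ofReal (le_greenHalf_of_mem_ball hs0 hs1 hns hC hx hR hy)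
    _ ≤ _ := lintegral_mono_set fun y hy => by
        have := (mem_ball_add_single_bounds hR0 hy).1
        simp only [mem_ofPred_eq]
        linarith
end
end
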